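/- Neither of the 3-dimensional superalgebras A_{1|1} = K[x,y]/(x², y², xy) and A_{1|2} = K[x,y]/(x², y² − x, xy), with x even and y odd, admits a superbialgebra structure: there exist no grading-preserving K-linear maps Δ : A → A ⊗ A and ε : A → K making either of these superalgebras into a superbialgebra. -/

import Mathlib

open TensorProduct

section SuperDefs

variable (K A : Type*) [Field K] [Ring A] [Algebra K A]

/-- A superalgebra structure on the unital associative `K`-algebra `A`: a `ℤ/2ℤ`-grading
`A = A₀ ⊕ A₁` of `K`-vector spaces with `1 ∈ A₀` and `Aᵢ · Aⱼ ⊆ A_{i+j mod 2}`. -/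
structure SuperAlgebra where
  A₀ : Submodule K A
  A₁ : Submodule K A
  compl : IsCompl A₀ A₁
  one_mem : (1 : A) ∈ A₀
  mul_mem₀₀ : ∀ a ∈ A₀, ∀ b ∈ A₀, a * b ∈ A₀
  mul_mem₀₁ : ∀ a ∈ A₀, ∀ b ∈ A₁, a * b ∈ A₁
  mul_mem₁₀ : ∀ a ∈ A₁, ∀ b ∈ A₀, a * b ∈ A₁
  mul_mem₁₁ : ∀ a ∈ A₁, ∀ b ∈ A₁, a * b ∈ A₀

namespace SuperAlgebra

variable {K A}

/-- The projection onto the even part along the odd part. -/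
noncomputable def p₀ (S : SuperAlgebra K A) : A →ₗ[K] A :=
  S.A₀.subtype ∘ₗ Submodule.linearProjOfIsCompl S.A₀ S.A₁ S.compl

/-- The projection onto the odd part along the even part. -/
noncomputable def p₁ (S : SuperAlgebra K A) : A →ₗ[K] A :=
  S.A₁.subtype ∘ₗ Submodule.linearProjOfIsCompl S.A₁ S.A₀ S.compl.symm

/-- The superflip `τ : A ⊗ A → A ⊗ A`, `a ⊗ b ↦ (-1)^{|a||b|} b ⊗ a` on homogeneous
elements. -/
noncomputable def τ (S : SuperAlgebra K A) : A ⊗[K] A →ₗ[K] A ⊗[K] A :=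
  (TensorProduct.comm K A A).toLinearMap ∘ₗ
    (TensorProduct.map S.p₀ S.p₀ + TensorProduct.map S.p₀ S.p₁ +
      TensorProduct.map S.p₁ S.p₀ - TensorProduct.map S.p₁ S.p₁)

variable (K A) in
/-- Regrouping `(A ⊗ A) ⊗ (A ⊗ A) ≃ A ⊗ ((A ⊗ A) ⊗ A)`. -/
noncomputable def rearr : ((A ⊗[K] A) ⊗[K] (A ⊗[K] A)) ≃ₗ[K] (A ⊗[K] ((A ⊗[K] A) ⊗[K] A)) :=
  (TensorProduct.assoc K A A (A ⊗[K] A)) ≪≫ₗ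
    TensorProduct.congr (LinearEquiv.refl K A) (TensorProduct.assoc K A A A).symm

/-- The map `(μ ⊗ μ) ∘ (id ⊗ τ ⊗ id) : (A ⊗ A) ⊗ (A ⊗ A) → A ⊗ A`, i.e. the super
multiplication of `A ⊗ A`. -/
noncomputable def superBimul (S : SuperAlgebra K A) :
    ((A ⊗[K] A) ⊗[K] (A ⊗[K] A)) →ₗ[K] A ⊗[K] A :=
  TensorProduct.map (LinearMap.mul' K A) (LinearMap.mul' K A) ∘ₗ
    (rearr K A).symm.toLinearMap ∘ₗ
    TensorProduct.map (LinearMap.id : A →ₗ[K] A)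
      (TensorProduct.map S.τ (LinearMap.id : A →ₗ[K] A)) ∘ₗ
    (rearr K A).toLinearMap

/-- The even part of `A ⊗ A` for the total grading. -/
def evenTensor (S : SuperAlgebra K A) : Submodule K (A ⊗[K] A) :=
  LinearMap.range (TensorProduct.map S.A₀.subtype S.A₀.subtype) ⊔
    LinearMap.range (TensorProduct.map S.A₁.subtype S.A₁.subtype)

/-- The odd part of `A ⊗ A` for the total grading. -/
def oddTensor (S : SuperAlgebra K A) : Submodule K (A ⊗[K] A) :=
  LinearMap.range (TensorProduct.map S.A₀.subtype S.A₁.subtype) ⊔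
    LinearMap.range (TensorProduct.map S.A₁.subtype S.A₀.subtype)

end SuperAlgebra

/-- A superbialgebra over `K`: a superalgebra together with grading-preserving linear maps
`Δ : A → A ⊗ A` and `ε : A → K` satisfying coassociativity, counity, and compatibility
with the (super)algebra structure. -/
structure SuperBialgebra extends SuperAlgebra K A where
  Δ : A →ₗ[K] A ⊗[K] A
  ε : A →ₗ[K] K
  Δ_even : ∀ a ∈ A₀, Δ a ∈ toSuperAlgebra.evenTensor
  Δ_odd : ∀ a ∈ A₁, Δ a ∈ toSuperAlgebra.oddTensor
  ε_odd : ∀ a ∈ A₁, ε a = 0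
  coassoc : ∀ a : A,
    TensorProduct.assoc K A A A (TensorProduct.map Δ (LinearMap.id : A →ₗ[K] A) (Δ a)) =
      TensorProduct.map (LinearMap.id : A →ₗ[K] A) Δ (Δ a)
  counit_left : ∀ a : A,
    TensorProduct.lid K A (TensorProduct.map ε (LinearMap.id : A →ₗ[K] A) (Δ a)) = a
  counit_right : ∀ a : A,
    TensorProduct.rid K A (TensorProduct.map (LinearMap.id : A →ₗ[K] A) ε (Δ a)) = a
  Δ_one : Δ 1 = 1 ⊗ₜ[K] 1
  ε_one : ε 1 = 1
  ε_mul : ∀ a b : A, ε (a * b) = ε a * ε b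
  Δ_mul : ∀ a b : A, Δ (a * b) = toSuperAlgebra.superBimul (Δ a ⊗ₜ[K] Δ b)

/-- A Hopf superalgebra: a superbialgebra with a grading-preserving antipode `S`
satisfying `μ ∘ (S ⊗ id) ∘ Δ = μ ∘ (id ⊗ S) ∘ Δ = η ∘ ε`. -/
structure HopfSuperalgebra extends SuperBialgebra K A where
  antipode : A →ₗ[K] A
  antipode_even : ∀ a ∈ A₀, antipode a ∈ A₀
  antipode_odd : ∀ a ∈ A₁, antipode a ∈ A₁
  antipode_left : ∀ a : A,
    LinearMap.mul' K A (TensorProduct.map antipode (LinearMap.id : A →ₗ[K] A) (Δ a)) =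
      algebraMap K A (ε a)
  antipode_right : ∀ a : A,
    LinearMap.mul' K A (TensorProduct.map (LinearMap.id : A →ₗ[K] A) antipode (Δ a)) =
      algebraMap K A (ε a)

end SuperDefs


theorem sb_even_form {K A : Type*} [Field K] [Ring A] [Algebra K A] (S : SuperAlgebra K A)
    (x y : A) (h0 : S.A₀ = Submodule.span K {1, x}) (h1 : S.A₁ = Submodule.span K {y})
    (z : A ⊗[K] A) (hz : z ∈ S.evenTensor) :
    ∃ a b c d e : K, z = a • ((1 : A) ⊗ₜ[K] (1 : A)) + b • ((1 : A) ⊗ₜ[K] x)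
      + c • (x ⊗ₜ[K] (1 : A)) + d • (x ⊗ₜ[K] x) + e • (y ⊗ₜ[K] y) := by
  obtain ⟨u, ⟨u', rfl⟩, v, ⟨v', rfl⟩, rfl⟩ := Submodule.mem_sup.1 hz
  clear hz
  have hu : ∃ a b c d : K, TensorProduct.map S.A₀.subtype S.A₀.subtype u' =
      a • ((1 : A) ⊗ₜ[K] (1 : A)) + b • ((1 : A) ⊗ₜ[K] x)
      + c • (x ⊗ₜ[K] (1 : A)) + d • (x ⊗ₜ[K] x) := by
    induction u' using TensorProduct.induction_on with
    | zero => exact ⟨0, 0, 0, 0, by simp⟩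
    | tmul p q =>
      obtain ⟨p, hp⟩ := p
      obtain ⟨q, hq⟩ := q
      rw [h0, Submodule.mem_span_pair] at hp hq
      obtain ⟨a, b, rfl⟩ := hp
      obtain ⟨c, d, rfl⟩ := hq
      refine ⟨a * c, a * d, b * c, b * d, ?_⟩
      simp only [TensorProduct.map_tmul, Submodule.subtype_apply, TensorProduct.add_tmul,
        TensorProduct.tmul_add, ← TensorProduct.smul_tmul', TensorProduct.tmul_smul]
      module
    | add p q hp hq =>
      obtain ⟨a, b, c, d, h⟩ := hp
      obtain ⟨a', b', c', d', h'⟩ := hq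
      refine ⟨a + a', b + b', c + c', d + d', ?_⟩
      rw [map_add, h, h']
      module
  have hv : ∃ e : K, TensorProduct.map S.A₁.subtype S.A₁.subtype v' = e • (y ⊗ₜ[K] y) := by
    induction v' using TensorProduct.induction_on with
    | zero => exact ⟨0, by simp⟩
    | tmul p q =>
      obtain ⟨p, hp⟩ := p
      obtain ⟨q, hq⟩ := q
      rw [h1, Submodule.mem_span_singleton] at hp hq
      obtain ⟨a, rfl⟩ := hp
      obtain ⟨c, rfl⟩ := hq
      refine ⟨c * a, ?_⟩
      simp [TensorProduct.smul_tmul', TensorProduct.tmul_smul, smul_smul]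
    | add p q hp hq =>
      obtain ⟨a, h⟩ := hp
      obtain ⟨a', h'⟩ := hq
      refine ⟨a + a', ?_⟩
      rw [map_add, h, h']
      module
  obtain ⟨a, b, c, d, h⟩ := hu
  obtain ⟨e, h'⟩ := hv
  exact ⟨a, b, c, d, e, by rw [h, h']⟩

theorem sb_odd_form {K A : Type*} [Field K] [Ring A] [Algebra K A] (S : SuperAlgebra K A)
    (x y : A) (h0 : S.A₀ = Submodule.span K {1, x}) (h1 : S.A₁ = Submodule.span K {y})
    (z : A ⊗[K] A) (hz : z ∈ S.oddTensor) :
    ∃ a b c d : K, z = a • ((1 : A) ⊗ₜ[K] y) + b • (x ⊗ₜ[K] y)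
      + c • (y ⊗ₜ[K] (1 : A)) + d • (y ⊗ₜ[K] x) := by
  obtain ⟨u, ⟨u', rfl⟩, v, ⟨v', rfl⟩, rfl⟩ := Submodule.mem_sup.1 hz
  clear hz
  have hu : ∃ a b : K, TensorProduct.map S.A₀.subtype S.A₁.subtype u' =
      a • ((1 : A) ⊗ₜ[K] y) + b • (x ⊗ₜ[K] y) := by
    induction u' using TensorProduct.induction_on with
    | zero => exact ⟨0, 0, by simp⟩
    | tmul p q =>
      obtain ⟨p, hp⟩ := p
      obtain ⟨q, hq⟩ := q
      rw [h0, Submodule.mem_span_pair] at hp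
      rw [h1, Submodule.mem_span_singleton] at hq
      obtain ⟨a, b, rfl⟩ := hp
      obtain ⟨c, rfl⟩ := hq
      refine ⟨a * c, b * c, ?_⟩
      simp only [TensorProduct.map_tmul, Submodule.subtype_apply, TensorProduct.add_tmul,
        TensorProduct.tmul_add, ← TensorProduct.smul_tmul', TensorProduct.tmul_smul]
      module
    | add p q hp hq =>
      obtain ⟨a, b, h⟩ := hp
      obtain ⟨a', b', h'⟩ := hq
      refine ⟨a + a', b + b', ?_⟩
      rw [map_add, h, h']
      module
  have hv : ∃ c d : K, TensorProduct.map S.A₁.subtype S.A₀.subtype v' =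
      c • (y ⊗ₜ[K] (1 : A)) + d • (y ⊗ₜ[K] x) := by
    induction v' using TensorProduct.induction_on with
    | zero => exact ⟨0, 0, by simp⟩
    | tmul p q =>
      obtain ⟨p, hp⟩ := p
      obtain ⟨q, hq⟩ := q
      rw [h1, Submodule.mem_span_singleton] at hp
      rw [h0, Submodule.mem_span_pair] at hq
      obtain ⟨a, rfl⟩ := hp
      obtain ⟨c, d, rfl⟩ := hq
      refine ⟨a * c, a * d, ?_⟩
      simp only [TensorProduct.map_tmul, Submodule.subtype_apply, TensorProduct.add_tmul,
        TensorProduct.tmul_add, ← TensorProduct.smul_tmul', TensorProduct.tmul_smul]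
      module
    | add p q hp hq =>
      obtain ⟨a, b, h⟩ := hp
      obtain ⟨a', b', h'⟩ := hq
      refine ⟨a + a', b + b', ?_⟩
      rw [map_add, h, h']
      module
  obtain ⟨a, b, h⟩ := hu
  obtain ⟨c, d, h'⟩ := hv
  exact ⟨a, b, c, d, by rw [h, h']; module⟩

theorem sb_bimul_tmul {K A : Type*} [Field K] [Ring A] [Algebra K A] (S : SuperAlgebra K A)
    (a b c d : A) : S.superBimul ((a ⊗ₜ[K] b) ⊗ₜ[K] (c ⊗ₜ[K] d)) =
      (a * S.p₀ c) ⊗ₜ[K] (S.p₀ b * d) + (a * S.p₁ c) ⊗ₜ[K] (S.p₀ b * d)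
      + (a * S.p₀ c) ⊗ₜ[K] (S.p₁ b * d) - (a * S.p₁ c) ⊗ₜ[K] (S.p₁ b * d) := by
  simp [SuperAlgebra.superBimul, SuperAlgebra.rearr, SuperAlgebra.τ,
    TensorProduct.add_tmul, TensorProduct.tmul_add, TensorProduct.sub_tmul, TensorProduct.tmul_sub]

theorem sb_coords {K A : Type*} [Field K] [Ring A] [Algebra K A] (x y : A)
    (hl : LinearIndependent K ![(1 : A), x, y]) (v : Fin 3 → K) :
    ∃ f : A →ₗ[K] K, f 1 = v 0 ∧ f x = v 1 ∧ f y = v 2 := by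
  obtain ⟨f, hf⟩ := LinearMap.exists_extend
    (p := Submodule.span K (Set.range ![(1 : A), x, y])) ((Module.Basis.span hl).constr K v)
  have key : ∀ i, f (![(1 : A), x, y] i) = v i := by
    intro i
    have h1 := (Module.Basis.span hl).constr_basis K v i
    rw [← hf] at h1
    simpa [Module.Basis.span_apply] using h1
  exact ⟨f, key 0, key 1, key 2⟩

theorem sb_core {K A : Type*} [Field K] [CharZero K] [Ring A] [Algebra K A]
    (B : SuperBialgebra K A) (x y : A) (t : K)
    (hx : x ∈ B.A₀) (hy : y ∈ B.A₁) (hl : LinearIndependent K ![(1 : A), x, y])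
    (h0 : B.A₀ = Submodule.span K {1, x}) (h1 : B.A₁ = Submodule.span K {y})
    (hxx : x * x = 0) (hxy : x * y = 0) (hyx : y * x = 0) (hyy : y * y = t • x)
    (ht : t = 0 ∨ t = 1) : False := by
  obtain ⟨f0, f00, f01, f02⟩ := sb_coords x y hl ![1, 0, 0]
  obtain ⟨f1, f10, f11, f12⟩ := sb_coords x y hl ![0, 1, 0]
  obtain ⟨f2, f20, f21, f22⟩ := sb_coords x y hl ![0, 0, 1]
  simp at f00 f01 f02 f10 f11 f12 f20 f21 f22
  have e1 := B.ε_one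
  have ex : B.ε x = 0 := by
    have := B.ε_mul x x
    rw [hxx, map_zero] at this
    exact mul_self_eq_zero.1 this.symm
  have ey := B.ε_odd y hy
  have p01 : B.p₀ 1 = 1 := by
    have := Submodule.projectionOnto_apply_left B.compl ⟨1, B.one_mem⟩
    exact congrArg Subtype.val this
  have p0x : B.p₀ x = x := by
    have := Submodule.projectionOnto_apply_left B.compl ⟨x, hx⟩
    exact congrArg Subtype.val this
  have p0y : B.p₀ y = 0 := by
    have := Submodule.projectionOnto_apply_right B.compl ⟨y, hy⟩
    exact congrArg Subtype.val this
  have p11 : B.p₁ 1 = 0 := by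
    have := Submodule.projectionOnto_apply_right B.compl.symm ⟨1, B.one_mem⟩
    exact congrArg Subtype.val this
  have p1x : B.p₁ x = 0 := by
    have := Submodule.projectionOnto_apply_right B.compl.symm ⟨x, hx⟩
    exact congrArg Subtype.val this
  have p1y : B.p₁ y = y := by
    have := Submodule.projectionOnto_apply_left B.compl.symm ⟨y, hy⟩
    exact congrArg Subtype.val this
  obtain ⟨a, b, c, d, e, hDx⟩ := sb_even_form B.toSuperAlgebra x y h0 h1 _ (B.Δ_even x hx)
  obtain ⟨a', b', c', d', hDy⟩ := sb_odd_form B.toSuperAlgebra x y h0 h1 _ (B.Δ_odd y hy)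
  have lx := B.counit_left x
  have rx := B.counit_right x
  have ly := B.counit_left y
  have ry := B.counit_right y
  simp [hDx, e1, ex, ey] at lx rx
  simp [hDy, e1, ex, ey] at ly ry
  have hb : b = 1 := by simpa [f10, f11] using congrArg f1 lx
  have ha : a = 0 := by simpa [f00, f01] using congrArg f0 lx
  have hc : c = 1 := by simpa [f10, f11] using congrArg f1 rx
  have ha' : a' = 1 := by simpa [f22] using congrArg f2 ly
  have hc' : c' = 1 := by simpa [f22] using congrArg f2 ry
  subst ha hb hc ha' hc'
  have m1 := B.Δ_mul x x
  have m2 := B.Δ_mul y y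
  rw [hxx, map_zero, hDx] at m1
  rw [hyy, map_smul, hDx, hDy] at m2
  simp only [TensorProduct.add_tmul, TensorProduct.tmul_add, ← TensorProduct.smul_tmul',
    TensorProduct.tmul_smul, map_add, map_smul, sb_bimul_tmul, p01, p0x, p0y, p11, p1x, p1y,
    hxx, hxy, hyx, hyy, mul_one, one_mul, mul_zero, zero_mul, TensorProduct.tmul_zero,
    TensorProduct.zero_tmul] at m1 m2
  have n1 := congrArg (fun z => LinearMap.mul' K K (TensorProduct.map f1 f1 z)) m1
  have n2 := congrArg (fun z => LinearMap.mul' K K (TensorProduct.map f2 f2 z)) m2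
  simp [f10, f11, f12, f20, f21, f22] at n1 n2
  rcases ht with rfl | rfl
  · simp at n1
    norm_num at n1
  · simp at n1 n2
    simp [n2] at n1
    norm_num at n1

/-- neither `A_{1|1} = K[x,y]/(x², y², xy)` nor
`A_{1|2} = K[x,y]/(x², y² - x, xy)` (with `x` even and `y` odd) carries a
superbialgebra structure. -/
theorem superalgebras_A11_A12_admit_no_superbialgebra
    {K A : Type*} [Field K] [IsAlgClosed K] [CharZero K] [Ring A] [Algebra K A] :
    (¬ ∃ (B : SuperBialgebra K A) (x y : A),
        x ∈ B.A₀ ∧ y ∈ B.A₁ ∧ LinearIndependent K ![(1 : A), x, y] ∧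
        B.A₀ = Submodule.span K {1, x} ∧ B.A₁ = Submodule.span K {y} ∧
        x * x = 0 ∧ x * y = 0 ∧ y * x = 0 ∧ y * y = 0) ∧
    (¬ ∃ (B : SuperBialgebra K A) (x y : A),
        x ∈ B.A₀ ∧ y ∈ B.A₁ ∧ LinearIndependent K ![(1 : A), x, y] ∧
        B.A₀ = Submodule.span K {1, x} ∧ B.A₁ = Submodule.span K {y} ∧
        x * x = 0 ∧ x * y = 0 ∧ y * x = 0 ∧ y * y = x) := by
  constructor
  · rintro ⟨B, x, y, hx, hy, hl, h0, h1, hxx, hxy, hyx, hyy⟩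
    exact sb_core B x y 0 hx hy hl h0 h1 hxx hxy hyx (by simpa using hyy) (Or.inl rfl)
  · rintro ⟨B, x, y, hx, hy, hl, h0, h1, hxx, hxy, hyx, hyy⟩
    exact sb_core B x y 1 hx hy hl h0 h1 hxx hxy hyx (by simpa using hyy) (Or.inr rfl)
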